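/- Let n ≥ 1 be an integer and let g be a 2×2 complex matrix with w₂(g) ≠ 0 and w₂′(g) ≠ 0. In the polynomial ring ℂ[X, Y], for 0 ≤ j ≤ n set b_j = (−1)^j · X^j · Y^{n−j}. For 0 ≤ j ≤ n let D_j denote the derivative at s = 0 of the function s ↦ φ^n_{n−2j}(g · [[1, s], [0, 1]]) (s ∈ ℂ). Then the following identity holds in ℂ[X, Y]: Σ_{j=0}^{n} [ X · (∂b_{n−j}/∂Y) · φ^n_{n−2j}(g) + b_{n−j} · D_j ] = (n + 1) · b₀ · φ^n_{−(n+2)}(g). (This is the telescoping computation v⁺θ_n = ((2πi)^{n+1}/2)·b₀ⁿ ⊗ φⁿ_{−(n+2)}, where θ_n = ((2πi)^{n+1}/(2(n+1)))·Σ_j b_{n−j} ⊗ φ^n_{n−2j}; it is the heart of the paper's proof that d(Eis_H^n(φ_f)) = π_n(Eis_B^n(φ_f)) in Deligne–Beilinson cohomology.) -/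

import Mathlib

open Matrix Complex MvPolynomial

noncomputable def w2 (g : Matrix (Fin 2) (Fin 2) ℂ) : ℂ := -g 0 1 + g 1 1

noncomputable def w2' (g : Matrix (Fin 2) (Fin 2) ℂ) : ℂ := g 0 0 - g 1 0

noncomputable def z2 (g : Matrix (Fin 2) (Fin 2) ℂ) : ℂ :=
  Complex.I * (g 0 1 + g 1 1) / (-g 0 1 + g 1 1)

noncomputable def z2' (g : Matrix (Fin 2) (Fin 2) ℂ) : ℂ :=
  Complex.I * (g 0 0 + g 1 0) / (-g 0 0 + g 1 0)

/-- The function `φ_r^n = (z₂ − z₂′) · w₂^{−(n−r)/2} · w₂′^{−(n+r)/2}`. -/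
noncomputable def phi (n r : ℤ) (g : Matrix (Fin 2) (Fin 2) ℂ) : ℂ :=
  (z2 g - z2' g) * w2 g ^ (-((n - r) / 2)) * w2' g ^ (-((n + r) / 2))

/-- The upper-triangular unipotent matrix `u⁺(s)`. -/
noncomputable def uplus (s : ℂ) : Matrix (Fin 2) (Fin 2) ℂ := !![1, s; 0, 1]

/-- The basis vector `b_j = (−1)^j X^j Y^{n−j}` of `Sym^n V₂` inside `ℂ[X, Y]`;
here `X 0` plays the role of `X` and `X 1` the role of `Y`. -/
noncomputable def bpoly (n j : ℕ) : MvPolynomial (Fin 2) ℂ :=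
  (-1 : MvPolynomial (Fin 2) ℂ) ^ j * X 0 ^ j * X 1 ^ (n - j)

lemma phi_sub_two_mul (n j : ℤ) (g : Matrix (Fin 2) (Fin 2) ℂ) (hw : w2 g ≠ 0)
    (hw' : w2' g ≠ 0) :
    phi n (n - 2 * j) g = 2 * I * g.det * w2 g ^ (-j - 1) * w2' g ^ (j - n - 1) := by
  have h1 : -((n - (n - 2 * j)) / 2) = -j := by omega
  have h2 : -((n + (n - 2 * j)) / 2) = j - n := by omega
  have hz : z2 g - z2' g = 2 * I * g.det * (w2 g)⁻¹ * (w2' g)⁻¹ := by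
    have hz2' : z2' g = -(I * (g 0 0 + g 1 0) / w2' g) := by
      rw [z2', w2', ← div_neg, neg_sub', sub_neg_eq_add]
    have hz2 : z2 g = I * (g 0 1 + g 1 1) / w2 g := rfl
    rw [hz2, hz2']
    field_simp
    rw [Matrix.det_fin_two, w2, w2']
    ring
  rw [phi, h1, h2, hz, zpow_sub_one₀ hw, zpow_sub_one₀ hw']
  ring

lemma w2_mul_uplus (g : Matrix (Fin 2) (Fin 2) ℂ) (s : ℂ) :
    w2 (g * uplus s) = w2 g - s * w2' g := by
  simp [w2, w2', uplus, Matrix.mul_apply, Fin.sum_univ_two]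
  ring

lemma w2'_mul_uplus (g : Matrix (Fin 2) (Fin 2) ℂ) (s : ℂ) :
    w2' (g * uplus s) = w2' g := by
  simp [w2', uplus, Matrix.mul_apply, Fin.sum_univ_two]

lemma det_mul_uplus (g : Matrix (Fin 2) (Fin 2) ℂ) (s : ℂ) :
    (g * uplus s).det = g.det := by
  simp [uplus, Matrix.det_fin_two_of]

/-- The raising operator sends `φ^n_{n-2j}` to `(j + 1) φ^n_{n-2(j+1)}`. -/
lemma hasDerivAt_phi_mul_uplus (n j : ℤ) (g : Matrix (Fin 2) (Fin 2) ℂ) (hw : w2 g ≠ 0)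
    (hw' : w2' g ≠ 0) :
    HasDerivAt (fun s : ℂ => phi n (n - 2 * j) (g * uplus s))
      ((j + 1) * phi n (n - 2 * (j + 1)) g) 0 := by
  have hlin : HasDerivAt (fun s : ℂ => w2 g - s * w2' g) (-w2' g) 0 := by
    simpa using ((hasDerivAt_id (0 : ℂ)).mul_const (w2' g)).const_sub (w2 g)
  have hne : w2 g - 0 * w2' g ≠ 0 := by simpa using hw
  have hpow := ((((hasDerivAt_zpow (-j - 1) (w2 g - 0 * w2' g) (Or.inl hne)).comp (0 : ℂ)
    hlin).const_mul (2 * I * g.det)).mul_const (w2' g ^ (j - n - 1)))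
  refine (hpow.congr_of_eventuallyEq ?_).congr_deriv ?_
  · filter_upwards [hlin.continuousAt.eventually_ne hne] with s hs
    rw [phi_sub_two_mul n j _ (by rwa [w2_mul_uplus]) (by rwa [w2'_mul_uplus]),
      w2_mul_uplus, w2'_mul_uplus, det_mul_uplus]
    rfl
  · have e1 : -(j + 1) - 1 = -j - 1 - 1 := by ring
    have e2 : j + 1 - n - 1 = j - n - 1 + 1 := by ring
    rw [phi_sub_two_mul n (j + 1) g hw hw', e1, e2, zpow_add_one₀ hw' (j - n - 1),
      zero_mul, sub_zero]
    push_cast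
    ring

lemma X_mul_pderiv_bpoly {n j : ℕ} (hj : j ≤ n) :
    X 0 * pderiv 1 (bpoly n (n - j)) = -((j : MvPolynomial (Fin 2) ℂ) * bpoly n (n + 1 - j)) := by
  obtain ⟨k, rfl⟩ := Nat.exists_eq_add_of_le hj
  have h1 : j + k - j = k := by omega
  have h2 : j + k - k = j := by omega
  have h3 : j + k + 1 - j = k + 1 := by omega
  have h4 : j + k - (k + 1) = j - 1 := by omega
  have hc : pderiv 1 ((-1 : MvPolynomial (Fin 2) ℂ) ^ k * X 0 ^ k) = 0 := by
    simp
  rw [h1, h3, bpoly, bpoly, h2, h4, pderiv_mul, hc, pderiv_pow, pderiv_X_self]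
  ring

/-- The telescoping computation `v⁺θ_n = ((2πi)^{n+1}/2)·b₀ⁿ ⊗ φⁿ_{−(n+2)}`, the heart of the
proof that `d(Eis_H^n(φ_f)) = π_n(Eis_B^n(φ_f))` in Deligne–Beilinson cohomology. -/
theorem stmt_8 (n : ℕ) (hn : 1 ≤ n) (g : Matrix (Fin 2) (Fin 2) ℂ)
    (hw : w2 g ≠ 0) (hw' : w2' g ≠ 0) :
    ∑ j ∈ Finset.range (n + 1),
      (X 0 * (pderiv 1 (bpoly n (n - j))) * C (phi (n : ℤ) ((n : ℤ) - 2 * (j : ℤ)) g)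
        + bpoly n (n - j) *
            C (deriv (fun s : ℂ => phi (n : ℤ) ((n : ℤ) - 2 * (j : ℤ)) (g * uplus s)) 0))
      = ((n : MvPolynomial (Fin 2) ℂ) + 1) *
          (bpoly n 0 * C (phi (n : ℤ) (-((n : ℤ) + 2)) g)) := by
  rw [Finset.sum_congr rfl (g := fun j : ℕ =>
    ((j + 1 : ℕ) : MvPolynomial (Fin 2) ℂ) * bpoly n (n + 1 - (j + 1)) *
        C (phi n (n - 2 * ((j + 1 : ℕ) : ℤ)) g)
      - (j : MvPolynomial (Fin 2) ℂ) * bpoly n (n + 1 - j) * C (phi n (n - 2 * (j : ℤ)) g)),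
    Finset.sum_range_sub (fun j : ℕ => (j : MvPolynomial (Fin 2) ℂ) * bpoly n (n + 1 - j) *
      C (phi n (n - 2 * (j : ℤ)) g))]
  · have h : (n : ℤ) - 2 * ((n + 1 : ℕ) : ℤ) = -((n : ℤ) + 2) := by push_cast; ring
    rw [h]
    simp [mul_assoc]
  · intro j hj
    rw [X_mul_pderiv_bpoly (Finset.mem_range_succ_iff.mp hj),
      (hasDerivAt_phi_mul_uplus n j g hw hw').deriv, Nat.add_sub_add_right]
    push_cast
    simp only [map_mul, map_add, map_one, map_natCast]
    ring
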